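/- arXiv:1401.0285 — 2 statements merged into one kernel-verified Lean document; each statement's English description precedes it below -/
import Mathlib

section
/- Let f, g : ℝ² → ℝ be continuous and bounded, and let C₀ > 0. For each ε ∈ (0,1) let (u_ε, v_ε) : [0,∞) → C_b(ℝ) × C_b(ℝ) be a continuously differentiable curve, 2π-periodic in x at each time, satisfying ∂ₜu_ε(x,t) = (1/ε)[u_ε(x−ε,t)f̃_ε(x−ε,t)⁺ − u_ε(x,t)|f̃_ε(x,t)| + u_ε(x+ε,t)f̃_ε(x+ε,t)⁻] and the analogous equation for v_ε with g̃_ε, where f̃_ε(x,t) = f(u_ε(x,t),v_ε(x,t)) and g̃_ε(x,t) = g(u_ε(x,t),v_ε(x,t)), and with ∫₀^{2π}|u_ε(x,t)|dx ≤ C₀ and ∫₀^{2π}|v_ε(x,t)|dx ≤ C₀ for all ε ∈ (0,1) and t ≥ 0. Then for every ψ ∈ C_c^∞(ℝ), sup_{t≥0} |∫_ℝ (∂ₜu_ε(x,t)ψ(x) − u_ε(x,t)f(u_ε(x,t),v_ε(x,t))ψ'(x)) dx| → 0 as ε → 0; i.e. (u_ε, v_ε) is a weak asymptotic method for the equation ∂ₜu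 + ∂ₓ(u·f(u,v)) = 0. -/
open MeasureTheory Set Real

theorem abs_taylor_remainder_le {ψ : ℝ → ℝ} (hd : Differentiable ℝ ψ) {K : NNReal}
    (hK : LipschitzWith K (deriv ψ)) (x h : ℝ) :
    |ψ (x + h) - ψ x - h * deriv ψ x| ≤ K * h ^ 2 := by
  have key := (convex_uIcc x (x + h)).norm_image_sub_le_of_norm_hasDerivWithin_le
    (f := fun y => ψ y - y * deriv ψ x) (f' := fun y => deriv ψ y - 1 * deriv ψ x)
    (C := K * |h|) (x := x) (y := x + h)
    (fun y _ => ((hd y).hasDerivAt.sub ((hasDerivAt_id y).mul_const _)).hasDerivWithinAt)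
    (fun y hy => by
      have h1 := hK.dist_le_mul y x
      have h2 : |y - x| ≤ |h| := by simpa using abs_sub_left_of_mem_uIcc hy
      rw [Real.dist_eq, Real.dist_eq] at h1
      rw [one_mul, Real.norm_eq_abs]
      exact h1.trans (by gcongr))
    left_mem_uIcc right_mem_uIcc
  rw [Real.norm_eq_abs, Real.norm_eq_abs] at key
  calc _ = |ψ (x + h) - (x + h) * deriv ψ x - (ψ x - x * deriv ψ x)| := by congr 1; ring
    _ ≤ K * |h| * |x + h - x| := key
    _ = K * h ^ 2 := by rw [add_sub_cancel_left, mul_assoc, abs_mul_abs_self]; ring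

/-- Summation by parts for the upwind difference operator. -/
theorem integral_upwind_sub_flux {P N ψ : ℝ → ℝ} (hP : Continuous P) (hN : Continuous N)
    (hψ : ContDiff ℝ 1 ψ) (hψc : HasCompactSupport ψ) (ε : ℝ) :
    ∫ x, (ε⁻¹ * (P (x - ε) - (P x + N x) + N (x + ε)) * ψ x - (P x - N x) * deriv ψ x) =
      ∫ x, (P x * (ε⁻¹ * (ψ (x + ε) - ψ x) - deriv ψ x)
        + N x * (ε⁻¹ * (ψ (x - ε) - ψ x) + deriv ψ x)) := by
  have hc := hψ.continuous
  have hd := hψ.continuous_deriv le_rfl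
  have int_mul {a b : ℝ → ℝ} (ha : Continuous a) (hb : Continuous b) (hbc : HasCompactSupport b) :
      Integrable (fun x => a x * b x) :=
    (ha.mul hb).integrable_of_hasCompactSupport hbc.mul_left
  have hsP : HasCompactSupport fun x => ψ (x + ε) :=
    hψc.comp_homeomorph (Homeomorph.addRight ε)
  have hsN : HasCompactSupport fun x => ψ (x - ε) :=
    hψc.comp_homeomorph (Homeomorph.subRight ε)
  have i1 : Integrable fun x => P (x - ε) * ψ x := int_mul (by fun_prop) hc hψc
  have i2 : Integrable fun x => N (x + ε) * ψ x := int_mul (by fun_prop) hc hψc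
  have i3 : Integrable fun x => P x * ψ (x + ε) := int_mul hP (by fun_prop) hsP
  have i4 : Integrable fun x => N x * ψ (x - ε) := int_mul hN (by fun_prop) hsN
  have e1 : ∫ x, P (x - ε) * ψ x = ∫ x, P x * ψ (x + ε) := by
    simpa using integral_sub_right_eq_self (fun x => P x * ψ (x + ε)) ε
  have e2 : ∫ x, N (x + ε) * ψ x = ∫ x, N x * ψ (x - ε) := by
    simpa using integral_add_right_eq_self (fun x => N x * ψ (x - ε)) ε
  set r : ℝ → ℝ := fun x => -(ε⁻¹ * ((P x + N x) * ψ x)) - (P x - N x) * deriv ψ x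
  have ir : Integrable r :=
    ((int_mul (hP.add hN) hc hψc).const_mul ε⁻¹).neg.sub (int_mul (hP.sub hN) hd hψc.deriv)
  calc _ = ∫ x, (ε⁻¹ * (P (x - ε) * ψ x + N (x + ε) * ψ x) + r x) := by
        congr 1; ext x; simp only [r]; ring
    _ = ∫ x, (ε⁻¹ * (P x * ψ (x + ε) + N x * ψ (x - ε)) + r x) := by
        have i12 : Integrable fun x => ε⁻¹ * (P (x - ε) * ψ x + N (x + ε) * ψ x) :=
          (i1.add i2).const_mul _
        have i34 : Integrable fun x => ε⁻¹ * (P x * ψ (x + ε) + N x * ψ (x - ε)) :=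
          (i3.add i4).const_mul _
        rw [integral_add i12 ir, integral_add i34 ir, integral_const_mul, integral_const_mul, integral_add i1 i2, integral_add i3 i4, e1, e2]
    _ = _ := by congr 1; ext x; simp only [r]; ring

theorem abs_integral_le_of_periodic {w F : ℝ → ℝ} {T c C : ℝ} (hw : Continuous w)
    (hper : Function.Periodic w T) (hT : 0 < T) (hC : ∫ x in (0 : ℝ)..T, |w x| ≤ C)
    (hc : 0 ≤ c) (n : ℕ) (hF : ∀ x, |F x| ≤ c * |w x|)
    (hsupp : ∀ x, n * T < |x| → F x = 0) :
    |∫ x, F x| ≤ c * (2 * n * C) := by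
  have habs : Function.Periodic (fun x => |w x|) T := fun x => by simp only [hper x]
  have hn : -(n * T) ≤ n * T := neg_le_self (by positivity)
  have hint : ∫ x in -(n * T)..n * T, |w x| ≤ 2 * n * C := by
    have h := habs.intervalIntegral_add_zsmul_eq (2 * n) (-(n * T))
      (fun a b => hw.abs.intervalIntegrable a b)
    rw [habs.intervalIntegral_add_eq (-(n * T)) 0, zero_add] at h
    have e : -(n * T) + (2 * n : ℤ) • T = n * T := by
      rw [zsmul_eq_mul]; push_cast; ring
    rw [e, zsmul_eq_mul] at h
    rw [h]; push_cast
    gcongr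
  have hset : ∫ x in Icc (-(n * T)) (n * T), F x = ∫ x, F x :=
    setIntegral_eq_integral_of_forall_compl_eq_zero fun x hx =>
      hsupp x (not_le.1 fun h => hx (abs_le.1 h))
  rw [← hset, integral_Icc_eq_integral_Ioc, ← Real.norm_eq_abs]
  calc _ ≤ ∫ x in Ioc (-(n * T)) (n * T), c * |w x| :=
        norm_integral_le_of_norm_le
          ((continuous_const.mul hw.abs).integrableOn_Ioc) (.of_forall hF)
    _ = c * ∫ x in -(n * T)..n * T, |w x| := by
        rw [integral_const_mul, intervalIntegral.integral_of_le hn]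
    _ ≤ _ := by gcongr

/-- The family `(u_ε, v_ε)` of `2π`-periodic, uniformly `L¹`-bounded solutions of the
coupled nonlinear discrete transport system is a weak asymptotic method for
`∂ₜu + ∂ₓ(u·f(u,v)) = 0`: for every test function `ψ`,
`sup_{t≥0} |∫ (∂ₜu_ε ψ − u_ε f(u_ε,v_ε) ψ') dx| → 0` as `ε → 0`. -/
theorem stmt17 (f g : ℝ × ℝ → ℝ) (hf_cont : Continuous f) (hg_cont : Continuous g)
    (hf_bdd : ∃ M : ℝ, ∀ p : ℝ × ℝ, |f p| ≤ M)
    (hg_bdd : ∃ M : ℝ, ∀ p : ℝ × ℝ, |g p| ≤ M)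
    (C₀ : ℝ) (hC₀ : 0 < C₀)
    (u v : ℝ → ℝ → BoundedContinuousFunction ℝ ℝ) -- `u ε t`, `v ε t`
    (hper : ∀ ε ∈ Ioo (0:ℝ) 1, ∀ t ∈ Ici (0:ℝ), ∀ x : ℝ,
      u ε t (x + 2*π) = u ε t x ∧ v ε t (x + 2*π) = v ε t x)
    (hode : ∀ ε ∈ Ioo (0:ℝ) 1, ∃ u' v' : ℝ → BoundedContinuousFunction ℝ ℝ,
      ContinuousOn u' (Ici 0) ∧ ContinuousOn v' (Ici 0) ∧
      (∀ t ∈ Ici (0:ℝ), HasDerivWithinAt (u ε) (u' t) (Ici 0) t) ∧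
      (∀ t ∈ Ici (0:ℝ), HasDerivWithinAt (v ε) (v' t) (Ici 0) t) ∧
      (∀ t ∈ Ici (0:ℝ), ∀ x : ℝ,
        u' t x = ε⁻¹ * (u ε t (x - ε) * max (f (u ε t (x - ε), v ε t (x - ε))) 0
          - u ε t x * |f (u ε t x, v ε t x)|
          + u ε t (x + ε) * max (-(f (u ε t (x + ε), v ε t (x + ε)))) 0)) ∧
      (∀ t ∈ Ici (0:ℝ), ∀ x : ℝ,
        v' t x = ε⁻¹ * (v ε t (x - ε) * max (g (u ε t (x - ε), v ε t (x - ε))) 0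
          - v ε t x * |g (u ε t x, v ε t x)|
          + v ε t (x + ε) * max (-(g (u ε t (x + ε), v ε t (x + ε)))) 0)))
    (hL1 : ∀ ε ∈ Ioo (0:ℝ) 1, ∀ t ∈ Ici (0:ℝ),
      (∫ x in (0:ℝ)..(2*π), |u ε t x|) ≤ C₀ ∧ (∫ x in (0:ℝ)..(2*π), |v ε t x|) ≤ C₀)
    (ψ : ℝ → ℝ) (hψ : ContDiff ℝ (⊤ : ℕ∞) ψ) (hψc : HasCompactSupport ψ) :
    ∀ η > (0:ℝ), ∃ ε₀ > (0:ℝ), ∀ ε ∈ Ioo (0:ℝ) 1, ε < ε₀ → ∀ t ∈ Ici (0:ℝ),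
      |∫ x, (derivWithin (fun s => u ε s x) (Ici 0) t * ψ x
        - u ε t x * f (u ε t x, v ε t x) * deriv ψ x)| < η := by
  obtain ⟨M, hM⟩ := hf_bdd
  have hM0 : 0 ≤ M := (abs_nonneg _).trans (hM 0)
  have hψd : Differentiable ℝ ψ := hψ.differentiable (by simp)
  have hψ1 : ContDiff ℝ 1 ψ := hψ.of_le (by exact_mod_cast le_top)
  have hdψ : ContDiff ℝ 1 (deriv ψ) :=
    (contDiff_infty_iff_deriv.1 hψ).2.of_le (by exact_mod_cast le_top)
  obtain ⟨K, hK⟩ := hdψ.lipschitzWith_of_hasCompactSupport hψc.deriv one_ne_zero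
  obtain ⟨R, hR⟩ := hψc.isCompact.isBounded.subset_closedBall 0
  have hψ0 : ∀ x, R < |x| → ψ x = 0 := fun x hx => image_eq_zero_of_notMem_tsupport fun h => by
    have := hR h
    rw [mem_closedBall_zero_iff, Real.norm_eq_abs] at this
    exact absurd this hx.not_ge
  have hdψ0 : ∀ x, R < |x| → deriv ψ x = 0 := fun x hx => image_eq_zero_of_notMem_tsupport
    fun h => by
    have := hR (tsupport_deriv_subset h)
    rw [mem_closedBall_zero_iff, Real.norm_eq_abs] at this
    exact absurd this hx.not_ge
  obtain ⟨n, hn⟩ := exists_nat_ge ((R + 1) / (2 * π))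
  rw [div_le_iff₀ two_pi_pos] at hn
  intro η hη
  set B : ℝ := 2 * M * K * (2 * n * C₀) with hB
  have hB0 : 0 ≤ B := by positivity
  refine ⟨η / (B + 1), by positivity, fun ε hε hεη t ht => ?_⟩
  have hε0 : 0 < ε := hε.1
  obtain ⟨u', v', -, -, hu, -, hueq, -⟩ := hode ε hε
  let w : ℝ → ℝ := fun x => u ε t x
  have hwc : Continuous w := (u ε t).continuous
  set φ : ℝ → ℝ := fun x => f (u ε t x, v ε t x) with hφ
  have hφc : Continuous φ := hf_cont.comp ((u ε t).continuous.prodMk (v ε t).continuous)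
  set P : ℝ → ℝ := fun x => w x * max (φ x) 0 with hP
  set N : ℝ → ℝ := fun x => w x * max (-(φ x)) 0 with hN
  have hsub : ∀ x, max (φ x) 0 - max (-(φ x)) 0 = φ x := fun x => by
    rcases le_total 0 (φ x) with h | h <;> simp [h]
  have hadd : ∀ x, max (φ x) 0 + max (-(φ x)) 0 = |φ x| := fun x => by
    rcases le_total 0 (φ x) with h | h <;> simp [h, abs_of_nonneg, abs_of_nonpos]
  have hderiv : ∀ x, derivWithin (fun s => u ε s x) (Ici 0) t =
      ε⁻¹ * (P (x - ε) - (P x + N x) + N (x + ε)) := fun x => by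
    have h := (BoundedContinuousFunction.evalCLM ℝ x).hasFDerivAt.comp_hasDerivWithinAt t (hu t ht)
    rw [show derivWithin (fun s => u ε s x) (Ici 0) t = u' t x from
      h.derivWithin (uniqueDiffOn_Ici 0 t ht), hueq t ht x]
    simp only [hP, hN, ← mul_add, hadd]
    rfl
  have hstep : ∀ x h : ℝ, |h| = ε →
      |ε⁻¹ * (ψ (x + h) - ψ x) - ε⁻¹ * (h * deriv ψ x)| ≤ K * ε := fun x h hh => by
    have := abs_taylor_remainder_le hψd hK x h
    rw [← mul_sub, abs_mul, abs_of_pos (inv_pos.2 hε0), inv_mul_le_iff₀ hε0]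
    rw [← sq_abs h, hh] at this
    linarith
  have hPN : ∀ x, |P x| ≤ M * |w x| ∧ |N x| ≤ M * |w x| := fun x => by
    have h := hM (u ε t x, v ε t x)
    have hmul {a : ℝ} (h0 : 0 ≤ a) (ha : a ≤ M) : |w x * a| ≤ M * |w x| := by
      rw [abs_mul, abs_of_nonneg h0, mul_comm]
      gcongr
    exact ⟨hmul (le_max_right _ _) (max_le ((le_abs_self _).trans h) hM0),
      hmul (le_max_right _ _) (max_le ((neg_le_abs _).trans h) hM0)⟩
  have hintegral : ∫ x, (derivWithin (fun s => u ε s x) (Ici 0) t * ψ x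
      - u ε t x * f (u ε t x, v ε t x) * deriv ψ x) =
      ∫ x, (P x * (ε⁻¹ * (ψ (x + ε) - ψ x) - deriv ψ x)
        + N x * (ε⁻¹ * (ψ (x - ε) - ψ x) + deriv ψ x)) := by
    rw [← integral_upwind_sub_flux (by fun_prop) (by fun_prop) hψ1 hψc]
    congr 1; ext x
    rw [hderiv x, show P x - N x = w x * φ x by rw [hP, hN, ← mul_sub, hsub]]
  rw [hintegral]
  refine (abs_integral_le_of_periodic (w := w) (T := 2 * π) (c := 2 * M * K * ε) (C := C₀) hwc
    (fun x => (hper ε hε t ht x).1) two_pi_pos (hL1 ε hε t ht).1 (by positivity) n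
    (fun x => ?_) (fun x hx => ?_)).trans_lt ?_
  · have h1 := hstep x ε (abs_of_pos hε0)
    have h2 := hstep x (-ε) (by rw [abs_neg, abs_of_pos hε0])
    rw [inv_mul_cancel_left₀ hε0.ne'] at h1
    rw [neg_mul, mul_neg, inv_mul_cancel_left₀ hε0.ne', sub_neg_eq_add, ← sub_eq_add_neg] at h2
    calc _ ≤ |P x| * |ε⁻¹ * (ψ (x + ε) - ψ x) - deriv ψ x|
          + |N x| * |ε⁻¹ * (ψ (x - ε) - ψ x) + deriv ψ x| := by
          rw [← abs_mul, ← abs_mul]; exact abs_add_le _ _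
      _ ≤ M * |w x| * (K * ε) + M * |w x| * (K * ε) := by
          gcongr
          exacts [(hPN x).1, (hPN x).2]
      _ = 2 * M * K * ε * |w x| := by ring
  · have hx' : R + 1 < |x| := hn.trans_lt hx
    have h1 : |x| ≤ |x + ε| + ε := by
      simpa [abs_of_pos hε0] using abs_sub (x + ε) ε
    have h2 : |x| ≤ |x - ε| + ε := by
      simpa [abs_of_pos hε0] using abs_add_le (x - ε) ε
    have hε1 := hε.2
    rw [hψ0 x (by linarith), hψ0 (x + ε) (by linarith), hψ0 (x - ε) (by linarith),
      hdψ0 x (by linarith)]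
    simp
  · rw [lt_div_iff₀ (by positivity)] at hεη
    calc _ = ε * B := by rw [hB]; ring
      _ ≤ ε * (B + 1) := by gcongr; linarith
      _ < η := hεη
end

section
/- Let s, a > 0 and let u : ℂ² → ℂ be holomorphic and bounded on S_s × D_a, where S_s = {z : |Im z| < s} and D_a = {t ∈ ℂ : |t| < a}. Let (ε_k) be a sequence of positive reals with ε_k → 0, and for each k let X_k : S_s × D_a → ℂ be holomorphic with sup_k sup_{S_s×D_a}|X_k| < ∞, satisfying ∂ₜX_k(z,t) = −(1/ε_k)(X_k(z,t)u(z,t) − X_k(z−ε_k,t)u(z−ε_k,t)) for all (z,t) ∈ S_s × D_a such that both z and z−ε_k lie in S_s. If X_k converges to a function X uniformly on compact subsets of S_s × D_a, then X is holomorphic on S_s × D_a and satisfies the transport equation ∂ₜX(z,t) = −∂_z(X(z,t)u(z,t)) for all (z,t) ∈ S_s × D_a. -/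
open Set Complex Filter

open Metric Topology in
/-- A locally uniform limit of holomorphic functions on an open subset of a finite-dimensional
complex normed space is holomorphic. -/
theorem differentiableOn_of_tendstoLocallyUniformlyOn {ι E F : Type*}
    [NormedAddCommGroup E] [NormedSpace ℂ E] [ProperSpace E]
    [NormedAddCommGroup F] [NormedSpace ℂ F] [CompleteSpace F]
    {l : Filter ι} [l.NeBot] {f : ι → E → F} {g : E → F} {U : Set E} (hU : IsOpen U)
    (hf : ∀ n, DifferentiableOn ℂ (f n) U) (hfg : TendstoLocallyUniformlyOn f g l U) :
    DifferentiableOn ℂ g U := by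
  intro x hx
  obtain ⟨R, hR, hRU⟩ := nhds_basis_closedBall.mem_iff.1 (hU.mem_nhds hx)
  obtain ⟨r, hr, rfl⟩ : ∃ r > 0, R = r + r := ⟨R / 2, half_pos hR, (add_halves R).symm⟩
  have hunif : TendstoUniformlyOn f g l (closedBall x (r + r)) :=
    (tendstoLocallyUniformlyOn_iff_forall_isCompact hU).1 hfg _ hRU (isCompact_closedBall x _)
  have hsub : ∀ y ∈ ball x r, ball y r ⊆ closedBall x (r + r) := fun y hy =>
    (ball_subset_ball' (by linarith [mem_ball.1 hy])).trans ball_subset_closedBall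
  have hball : ball x r ⊆ U := fun y hy => hRU (hsub y hy (mem_ball_self hr))
  have hdiff : ∀ n, ∀ y ∈ ball x r, DifferentiableAt ℂ (f n) y := fun n y hy =>
    (hf n).differentiableAt (hU.mem_nhds (hball hy))
  have hcauchy : UniformCauchySeqOn (fun n => fderiv ℂ (f n)) l (ball x r) := by
    intro V hV
    obtain ⟨δ, hδ, hδV⟩ := Metric.mem_uniformity_dist.1 hV
    have hη : 0 < δ * r / 4 := by positivity
    filter_upwards [hunif.uniformCauchySeqOn _ (Metric.dist_mem_uniformity hη)] with mn hmn y hy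
    apply hδV
    have hmem : ∀ w ∈ ball y r, ‖f mn.1 w - f mn.2 w‖ < δ * r / 4 := fun w hw => by
      simpa [dist_eq_norm] using hmn w (hsub y hy hw)
    have hmaps : MapsTo (f mn.1 - f mn.2) (ball y r)
        (closedBall ((f mn.1 - f mn.2) y) (δ * r / 2)) := fun w hw => by
      rw [mem_closedBall, dist_eq_norm]
      calc ‖(f mn.1 w - f mn.2 w) - (f mn.1 y - f mn.2 y)‖
          ≤ ‖f mn.1 w - f mn.2 w‖ + ‖f mn.1 y - f mn.2 y‖ := norm_sub_le _ _
        _ ≤ δ * r / 2 := by linarith [hmem w hw, hmem y (mem_ball_self hr)]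
    have hd : DifferentiableOn ℂ (f mn.1 - f mn.2) (ball y r) :=
      ((hf _).sub (hf _)).mono ((hsub y hy).trans hRU)
    have hle := Complex.norm_fderiv_le_div_of_mapsTo_ball hd hmaps hr
    rw [fderiv_sub (hdiff _ y hy) (hdiff _ y hy)] at hle
    rw [dist_eq_norm]
    refine hle.trans_lt ?_
    rw [div_lt_iff₀ hr]
    nlinarith [mul_pos hδ hr]
  have hlim : ∀ y ∈ ball x r, ∃ L, Tendsto (fun n => fderiv ℂ (f n) y) l (𝓝 L) := fun y hy =>
    cauchy_map_iff_exists_tendsto.1 (hcauchy.cauchy_map hy)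
  choose! g' hg' using hlim
  exact (hasFDerivAt_of_tendstoUniformlyOn isOpen_ball
    (hcauchy.tendstoUniformlyOn_of_tendsto hg')
    (fun n y hy => (hdiff n y hy).hasFDerivAt)
    (fun y hy => hfg.tendsto_at (hball hy)) (mem_ball_self hr)
    ).differentiableAt.differentiableWithinAt

open Metric Topology in
/-- If holomorphic functions `G k` converge locally uniformly to `g`, then difference quotients
of `G k` with steps tending to zero converge to the derivative of `g`. -/
theorem tendsto_backward_slope_of_tendstoLocallyUniformlyOn {ι : Type*} {l : Filter ι} [l.NeBot]
    {G : ι → ℂ → ℂ} {g : ℂ → ℂ} {U : Set ℂ} (hU : IsOpen U)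
    (hG : ∀ k, DifferentiableOn ℂ (G k) U) (hGg : TendstoLocallyUniformlyOn G g l U)
    {h : ι → ℂ} (h_ne : ∀ k, h k ≠ 0) (h_lim : Tendsto h l (𝓝 0)) {z : ℂ} (hz : z ∈ U) :
    Tendsto (fun k => (h k)⁻¹ * (G k z - G k (z - h k))) l (𝓝 (deriv g z)) := by
  have hev : ∀ᶠ k in l, DifferentiableOn ℂ (G k) U := Eventually.of_forall hG
  have hder := hGg.deriv hev hU
  have hcont : ContinuousAt (deriv g) z :=
    (((hGg.differentiableOn hev hU).deriv hU).differentiableAt (hU.mem_nhds hz)).continuousAt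
  rw [Metric.tendsto_nhds]
  intro η hη
  obtain ⟨t, ht, htk⟩ := Metric.tendstoLocallyUniformlyOn_iff.1 hder (η / 4) (by positivity) z hz
  rw [hU.nhdsWithin_eq hz] at ht
  obtain ⟨δ, hδ, hball⟩ := Metric.mem_nhds_iff.1 (inter_mem (inter_mem ht (hU.mem_nhds hz))
    (hcont.preimage_mem_nhds (ball_mem_nhds _ (by positivity : 0 < η / 4))))
  filter_upwards [htk, h_lim.eventually (ball_mem_nhds 0 hδ)] with k hk hhk
  have hderiv : ∀ w ∈ ball z δ, HasDerivWithinAt (fun w => G k w - w * deriv g z)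
      (deriv (G k) w - deriv g z) (ball z δ) w := fun w hw => by
    have h1 := ((hG k).differentiableAt (hU.mem_nhds (hball hw).1.2)).hasDerivAt
    have h2 := (hasDerivAt_id w).mul_const (deriv g z)
    rw [one_mul] at h2
    exact (h1.sub h2).hasDerivWithinAt
  have hbound : ∀ w ∈ ball z δ, ‖deriv (G k) w - deriv g z‖ ≤ η / 2 := fun w hw => by
    have h1 : dist (deriv g w) (deriv (G k) w) < η / 4 := hk w (hball hw).1.1
    have h2 : dist (deriv g w) (deriv g z) < η / 4 := (hball hw).2
    rw [← dist_eq_norm]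
    linarith [dist_triangle_left (deriv (G k) w) (deriv g z) (deriv g w)]
  have hmem : z - h k ∈ ball z δ := by simpa [dist_eq_norm] using hhk
  have hle := (convex_ball z δ).norm_image_sub_le_of_norm_hasDerivWithin_le hderiv hbound
    hmem (mem_ball_self hδ)
  have hpos : 0 < ‖h k‖ := norm_pos_iff.2 (h_ne k)
  have heq : (h k)⁻¹ * (G k z - G k (z - h k)) - deriv g z =
      (h k)⁻¹ * ((G k z - z * deriv g z) - (G k (z - h k) - (z - h k) * deriv g z)) := by
    field_simp [h_ne k]
    ring
  rw [dist_eq_norm, heq, norm_mul, norm_inv, inv_mul_lt_iff₀ hpos]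
  rw [sub_sub_cancel] at hle
  nlinarith

/-- A locally uniform limit of uniformly bounded holomorphic solutions of the
discretized transport equation
`∂ₜX_k(z,t) = −(1/ε_k)(X_k(z,t)u(z,t) − X_k(z−ε_k,t)u(z−ε_k,t))` on the strip-disk
domain `S_s × D_a`, with `ε_k → 0`, is holomorphic and satisfies the transport
equation `∂ₜX = −∂_z(Xu)`. -/
theorem stmt19 (s a : ℝ) (hs : 0 < s) (ha : 0 < a)
    (u : ℂ → ℂ → ℂ)
    (hu : DifferentiableOn ℂ (fun p : ℂ × ℂ => u p.1 p.2)
      ({z : ℂ | |z.im| < s} ×ˢ {t : ℂ | ‖t‖ < a}))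
    (hu_bdd : ∃ C : ℝ, ∀ z ∈ {z : ℂ | |z.im| < s}, ∀ t ∈ {t : ℂ | ‖t‖ < a},
      ‖u z t‖ ≤ C)
    (ε : ℕ → ℝ) (hε_pos : ∀ k, 0 < ε k) (hε_lim : Tendsto ε atTop (nhds 0))
    (Xk : ℕ → ℂ → ℂ → ℂ)
    (hXk : ∀ k, DifferentiableOn ℂ (fun p : ℂ × ℂ => Xk k p.1 p.2)
      ({z : ℂ | |z.im| < s} ×ˢ {t : ℂ | ‖t‖ < a}))
    (hXk_bdd : ∃ C : ℝ, ∀ k, ∀ z ∈ {z : ℂ | |z.im| < s}, ∀ t ∈ {t : ℂ | ‖t‖ < a},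
      ‖Xk k z t‖ ≤ C)
    (hXk_ode : ∀ k, ∀ z : ℂ, ∀ t : ℂ, |z.im| < s → |(z - (ε k : ℂ)).im| < s → ‖t‖ < a →
      HasDerivAt (fun τ => Xk k z τ)
        (-(ε k : ℂ)⁻¹ * (Xk k z t * u z t
          - Xk k (z - (ε k : ℂ)) t * u (z - (ε k : ℂ)) t)) t)
    (X : ℂ → ℂ → ℂ)
    (hconv : TendstoLocallyUniformlyOn (fun k (p : ℂ × ℂ) => Xk k p.1 p.2)
      (fun p : ℂ × ℂ => X p.1 p.2) atTop
      ({z : ℂ | |z.im| < s} ×ˢ {t : ℂ | ‖t‖ < a})) :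
    DifferentiableOn ℂ (fun p : ℂ × ℂ => X p.1 p.2)
      ({z : ℂ | |z.im| < s} ×ˢ {t : ℂ | ‖t‖ < a}) ∧
    ∀ z ∈ {z : ℂ | |z.im| < s}, ∀ t ∈ {t : ℂ | ‖t‖ < a},
      deriv (fun τ => X z τ) t = -deriv (fun ζ => X ζ t * u ζ t) z := by
  have hSo : IsOpen {z : ℂ | |z.im| < s} :=
    isOpen_lt (continuous_abs.comp continuous_im) continuous_const
  have hDo : IsOpen {t : ℂ | ‖t‖ < a} := isOpen_lt continuous_norm continuous_const
  refine ⟨differentiableOn_of_tendstoLocallyUniformlyOn (hSo.prod hDo) hXk hconv,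
    fun z hz t ht => ?_⟩
  have hmapsT : MapsTo (fun τ : ℂ => (z, τ)) {t : ℂ | ‖t‖ < a}
      ({z : ℂ | |z.im| < s} ×ˢ {t : ℂ | ‖t‖ < a}) := fun τ hτ => ⟨hz, hτ⟩
  have hmapsZ : MapsTo (fun ζ : ℂ => (ζ, t)) {z : ℂ | |z.im| < s}
      ({z : ℂ | |z.im| < s} ×ˢ {t : ℂ | ‖t‖ < a}) := fun ζ hζ => ⟨hζ, ht⟩
  have hdT : DifferentiableOn ℂ (fun τ : ℂ => (z, τ)) {t : ℂ | ‖t‖ < a} := by fun_prop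
  have hdZ : DifferentiableOn ℂ (fun ζ : ℂ => (ζ, t)) {z : ℂ | |z.im| < s} := by fun_prop
  have hconvT : TendstoLocallyUniformlyOn (fun k τ => Xk k z τ) (fun τ => X z τ) atTop
      {t : ℂ | ‖t‖ < a} := hconv.comp _ hmapsT hdT.continuousOn
  have hconvZ : TendstoLocallyUniformlyOn (fun k ζ => Xk k ζ t) (fun ζ => X ζ t) atTop
      {z : ℂ | |z.im| < s} := hconv.comp _ hmapsZ hdZ.continuousOn
  have hXkT : ∀ k, DifferentiableOn ℂ (fun τ => Xk k z τ) {t : ℂ | ‖t‖ < a} := fun k =>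
    (hXk k).comp hdT hmapsT
  have hXkZ : ∀ k, DifferentiableOn ℂ (fun ζ => Xk k ζ t) {z : ℂ | |z.im| < s} := fun k =>
    (hXk k).comp hdZ hmapsZ
  have huZ : DifferentiableOn ℂ (fun ζ => u ζ t) {z : ℂ | |z.im| < s} := hu.comp hdZ hmapsZ
  have hXZ : DifferentiableOn ℂ (fun ζ => X ζ t) {z : ℂ | |z.im| < s} :=
    hconvZ.differentiableOn (Eventually.of_forall hXkZ) hSo
  have hconst : TendstoLocallyUniformlyOn (fun (_ : ℕ) ζ => u ζ t) (fun ζ => u ζ t) atTop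
      {z : ℂ | |z.im| < s} := fun V hV ζ _ =>
    ⟨univ, univ_mem, Eventually.of_forall fun _ _ _ => refl_mem_uniformity hV⟩
  have hprod : TendstoLocallyUniformlyOn (fun k ζ => Xk k ζ t * u ζ t)
      (fun ζ => X ζ t * u ζ t) atTop {z : ℂ | |z.im| < s} :=
    hconvZ.mul₀ hconst hXZ.continuousOn huZ.continuousOn
  have hε : Tendsto (fun k => (ε k : ℂ)) atTop (nhds 0) := by
    exact_mod_cast (continuous_ofReal.tendsto 0).comp hε_lim
  have hslope := tendsto_backward_slope_of_tendstoLocallyUniformlyOn hSo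
    (fun k => (hXkZ k).mul huZ) hprod
    (fun k => ofReal_ne_zero.2 (hε_pos k).ne') hε hz
  have htime : Tendsto (fun k => deriv (fun τ => Xk k z τ) t) atTop
      (nhds (deriv (fun τ => X z τ) t)) :=
    (hconvT.deriv (Eventually.of_forall hXkT) hDo).tendsto_at ht
  refine tendsto_nhds_unique htime (hslope.neg.congr fun k => ?_)
  rw [(hXk_ode k z t hz (by simpa using hz) ht).deriv, neg_mul]
  rfl
end
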